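/- arXiv:cs/0607132 — 2 statements merged into one kernel-verified Lean document; each statement's English description precedes it below -/
import Mathlib

section
/- Let q ≥ 2 be an integer and ℓ ∈ {0,1,…,q−2}. There exists a real number β(ℓ,q) ≤ ⌈q/(ℓ+1)⌉ such that lim_{n→∞} (LA_u(n,ℓ)_q)^{1/n} = β(ℓ,q). -/
open Finset Filter

/-- `x` is a word over the alphabet `Q = {0,1,…,q-1}`. -/
def inQ (q : ℤ) {n : ℕ} (x : Fin n → ℤ) : Prop :=
  ∀ i, 0 ≤ x i ∧ x i ≤ q - 1

/-- `d(x,y) = max_i |x_i - y_i|`. -/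
def dmax {n : ℕ} (x y : Fin n → ℤ) : ℤ :=
  ((Finset.univ.sup fun i => (x i - y i).natAbs : ℕ) : ℤ)

/-- `d_u(x,y)`: equals `d(x,y)` if `x ≥ y` or `y ≥ x`, and `2·d(x,y)` otherwise. -/
def du {n : ℕ} (x y : Fin n → ℤ) : ℤ :=
  if (∀ i, y i ≤ x i) ∨ (∀ i, x i ≤ y i) then dmax x y else 2 * dmax x y

/-- Maximum size of an `ℓ`-AEC code in `Q^n`. -/
noncomputable def Aa (q : ℤ) (n : ℕ) (ℓ : ℤ) : ℕ :=
  sSup {k : ℕ | ∃ C : Finset (Fin n → ℤ), (∀ x ∈ C, inQ q x) ∧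
    (∀ x ∈ C, ∀ y ∈ C, x ≠ y → ℓ + 1 ≤ dmax x y) ∧ C.card = k}

/-- Maximum size of an `ℓ`-UEC code in `Q^n`. -/
noncomputable def Au (q : ℤ) (n : ℕ) (ℓ : ℤ) : ℕ :=
  sSup {k : ℕ | ∃ C : Finset (Fin n → ℤ), (∀ x ∈ C, inQ q x) ∧
    (∀ x ∈ C, ∀ y ∈ C, x ≠ y → 2 * ℓ + 1 ≤ du x y) ∧ C.card = k}

/-- `C` is a code of Varshamov–Tenengolts type: the solution set in `Q^n`
of a linear equation `Σ aᵢ xᵢ = a` over `ℤ`. -/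
def IsVT (q : ℤ) {n : ℕ} (C : Finset (Fin n → ℤ)) : Prop :=
  ∃ (coef : Fin n → ℤ) (a : ℤ),
    ∀ x : Fin n → ℤ, x ∈ C ↔ (inQ q x ∧ ∑ i, coef i * x i = a)

/-- Maximum size of a VT-type `ℓ`-AEC code in `Q^n`. -/
noncomputable def LAa (q : ℤ) (n : ℕ) (ℓ : ℤ) : ℕ :=
  sSup {k : ℕ | ∃ C : Finset (Fin n → ℤ), IsVT q C ∧
    (∀ x ∈ C, ∀ y ∈ C, x ≠ y → ℓ + 1 ≤ dmax x y) ∧ C.card = k}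

/-- Maximum size of a VT-type `ℓ`-UEC code in `Q^n`. -/
noncomputable def LAu (q : ℤ) (n : ℕ) (ℓ : ℤ) : ℕ :=
  sSup {k : ℕ | ∃ C : Finset (Fin n → ℤ), IsVT q C ∧
    (∀ x ∈ C, ∀ y ∈ C, x ≠ y → 2 * ℓ + 1 ≤ du x y) ∧ C.card = k}

/-- `γ_n(r) = |C_n(r)|` where
`C_n(r) = {x ∈ Q^n : Σ (ℓ+1)^i x_i = α·S_n + r}`, `α = ⌊(q-1)/2⌋`,
`S_n = Σ_{i<n} (ℓ+1)^i`. -/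
noncomputable def gam (q ℓ : ℤ) (n : ℕ) (r : ℤ) : ℕ :=
  Set.ncard {x : Fin n → ℤ | inQ q x ∧
    ∑ i : Fin n, (ℓ + 1) ^ (i : ℕ) * x i
      = ((q - 1) / 2) * (∑ i ∈ Finset.range n, (ℓ + 1) ^ i) + r}

lemma le_dmax_iff {n : ℕ} {x y : Fin n → ℤ} {k : ℤ} (hk : 0 < k) :
    k ≤ dmax x y ↔ ∃ i, k ≤ |x i - y i| := by
  lift k to ℕ using hk.le
  have hk' : (⊥ : ℕ) < k := by simpa using hk
  rw [dmax, Nat.cast_le, Finset.le_sup_iff hk']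
  simp only [Finset.mem_univ, true_and]
  exact exists_congr fun i => by rw [Int.abs_eq_natAbs, Nat.cast_le]

lemma le_du_iff {n : ℕ} {x y : Fin n → ℤ} {ℓ : ℤ} (hℓ : 0 ≤ ℓ) :
    2 * ℓ + 1 ≤ du x y ↔ (∃ i, ℓ + 1 ≤ |x i - y i|) ∧
      (((∀ i, y i ≤ x i) ∨ (∀ i, x i ≤ y i)) → ∃ i, 2 * ℓ + 1 ≤ |x i - y i|) := by
  rw [← le_dmax_iff (by omega), ← le_dmax_iff (by omega), du]
  split_ifs with h
  · simp only [h, true_implies]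
    omega
  · simp only [h, false_implies, and_true]
    omega

/-- The VT-type `ℓ`-UEC codes in `Q^n`. -/
def IsVTUEC (q ℓ : ℤ) {n : ℕ} (C : Finset (Fin n → ℤ)) : Prop :=
  IsVT q C ∧ ∀ x ∈ C, ∀ y ∈ C, x ≠ y → 2 * ℓ + 1 ≤ du x y

/-- Each product of blocks of `ℓ + 1` consecutive letters contains at most one codeword. -/
lemma IsVTUEC.card_le {q ℓ : ℤ} (hℓ : 0 ≤ ℓ) {K n : ℕ} (hK : q ≤ K * (ℓ + 1))
    {C : Finset (Fin n → ℤ)} (hC : IsVTUEC q ℓ C) : C.card ≤ K ^ n := by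
  obtain ⟨⟨coef, a, hvt⟩, hd⟩ := hC
  have hcard : (Fintype.piFinset fun _ : Fin n => Finset.Ico (0 : ℤ) K).card = K ^ n := by simp
  rw [← hcard]
  refine Finset.card_le_card_of_injOn (fun x i => x i / (ℓ + 1)) ?_ ?_
  · intro x hx
    have hxq := ((hvt x).1 hx).1
    simp only [Finset.mem_coe, Fintype.mem_piFinset, Finset.mem_Ico]
    intro i
    refine ⟨Int.ediv_nonneg (hxq i).1 (by omega), ?_⟩
    exact Int.ediv_lt_of_lt_mul (by omega) (by linarith [(hxq i).2])
  · intro x hx y hy hxy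
    by_contra hne
    obtain ⟨⟨i, hi⟩, -⟩ := (le_du_iff hℓ).1 (hd x hx y hy hne)
    have hdiv : x i / (ℓ + 1) = y i / (ℓ + 1) := congrFun hxy i
    have hpos : 0 < ℓ + 1 := by omega
    have hx1 := Int.emod_add_mul_ediv (x i) (ℓ + 1)
    have hy1 := Int.emod_add_mul_ediv (y i) (ℓ + 1)
    rw [hdiv] at hx1
    have := Int.emod_nonneg (x i) hpos.ne'
    have := Int.emod_nonneg (y i) hpos.ne'
    have := Int.emod_lt_of_pos (x i) hpos
    have := Int.emod_lt_of_pos (y i) hpos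
    have : |x i - y i| < ℓ + 1 := by
      rw [abs_lt]
      constructor <;> linarith
    linarith

lemma isVTUEC_singleton_zero {q ℓ : ℤ} (hq : 1 ≤ q) (n : ℕ) :
    IsVTUEC q ℓ ({0} : Finset (Fin n → ℤ)) := by
  refine ⟨⟨fun _ => 1, 0, fun x => ?_⟩, ?_⟩
  · rw [Finset.mem_singleton]
    constructor
    · rintro rfl
      exact ⟨fun i => ⟨le_rfl, by simpa using hq⟩, by simp⟩
    · rintro ⟨hx, hsum⟩
      simp only [one_mul] at hsum
      funext i
      exact (Finset.sum_eq_zero_iff_of_nonneg fun i _ => (hx i).1).1 hsum i (Finset.mem_univ i)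
  · simp only [Finset.mem_singleton]
    rintro x rfl y rfl h
    exact absurd rfl h

lemma inQ_append {q : ℤ} {m n : ℕ} {x : Fin m → ℤ} {y : Fin n → ℤ} :
    inQ q (Fin.append x y) ↔ inQ q x ∧ inQ q y := by
  simp [inQ, Fin.forall_fin_add]

lemma abs_sum_mul_le {q : ℤ} {n : ℕ} (coef : Fin n → ℤ) {x : Fin n → ℤ} (hx : inQ q x) :
    |∑ i, coef i * x i| ≤ ∑ i, |coef i| * (q - 1) := by
  refine (Finset.abs_sum_le_sum_abs _ _).trans (Finset.sum_le_sum fun i _ => ?_)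
  rw [abs_mul, abs_of_nonneg (hx i).1]
  exact mul_le_mul_of_nonneg_left (hx i).2 (abs_nonneg _)

/-- The concatenation of all words of `C` with all words of `D`. -/
def concatCode {m n : ℕ} (C : Finset (Fin m → ℤ)) (D : Finset (Fin n → ℤ)) :
    Finset (Fin (m + n) → ℤ) :=
  (C ×ˢ D).map (Fin.appendEquiv m n).toEmbedding

lemma card_concatCode {m n : ℕ} (C : Finset (Fin m → ℤ)) (D : Finset (Fin n → ℤ)) :
    (concatCode C D).card = C.card * D.card := by
  simp [concatCode]

lemma append_mem_concatCode {m n : ℕ} {C : Finset (Fin m → ℤ)} {D : Finset (Fin n → ℤ)}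
    {x : Fin m → ℤ} {y : Fin n → ℤ} :
    Fin.append x y ∈ concatCode C D ↔ x ∈ C ∧ y ∈ D := by
  rw [concatCode, show Fin.append x y = (Fin.appendEquiv m n).toEmbedding (x, y) from rfl,
    Finset.mem_map', Finset.mem_product]

lemma forall_append {m n : ℕ} {P : (Fin (m + n) → ℤ) → Prop} :
    (∀ z, P z) ↔ ∀ x y, P (Fin.append x y) :=
  (Fin.appendEquiv m n).surjective.forall.trans Prod.forall

/-- A linear equation for `C` and a linear equation for `D` combine into one for `concatCode C D`
after scaling the second by more than the range of the first. -/
lemma IsVT.concatCode {q : ℤ} {m n : ℕ} {C : Finset (Fin m → ℤ)}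
    {D : Finset (Fin n → ℤ)} (hC : IsVT q C) (hD : IsVT q D) : IsVT q (concatCode C D) := by
  obtain ⟨c, a, hc⟩ := hC
  obtain ⟨d, b, hd⟩ := hD
  set M : ℤ := |∑ i, |c i| * (q - 1)| + |a| + 1
  have hM : 0 < M := by positivity
  refine ⟨Fin.append c fun j => M * d j, a + M * b, forall_append.2 fun x y => ?_⟩
  rw [append_mem_concatCode, hc, hd, inQ_append, Fin.sum_univ_add]
  simp only [Fin.append_left, Fin.append_right, mul_assoc, ← Finset.mul_sum]
  constructor
  · rintro ⟨⟨hx, h1⟩, hy, h2⟩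
    exact ⟨⟨hx, hy⟩, by rw [h1, h2]⟩
  · rintro ⟨⟨hx, hy⟩, h⟩
    have hlt : |∑ i, c i * x i - a| < M := by
      have h1 := abs_sub (∑ i, c i * x i) a
      have h2 := abs_sum_mul_le c hx
      have h3 := le_abs_self (∑ i, |c i| * (q - 1))
      linarith
    have h0 : ∑ i, c i * x i - a = 0 :=
      Int.eq_zero_of_abs_lt_dvd ⟨b - ∑ j, d j * y j, by linear_combination h⟩ hlt
    refine ⟨⟨hx, sub_eq_zero.1 h0⟩, hy, mul_left_cancel₀ hM.ne' ?_⟩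
    linear_combination h - h0

lemma IsVTUEC.concatCode {q ℓ : ℤ} (hℓ : 0 ≤ ℓ) {m n : ℕ} {C : Finset (Fin m → ℤ)}
    {D : Finset (Fin n → ℤ)} (hC : IsVTUEC q ℓ C) (hD : IsVTUEC q ℓ D) :
    IsVTUEC q ℓ (concatCode C D) := by
  refine ⟨hC.1.concatCode hD.1, ?_⟩
  rw [forall_append]
  intro x y hxy
  rw [forall_append]
  intro x' y' hxy' hne
  obtain ⟨hx, hy⟩ := append_mem_concatCode.1 hxy
  obtain ⟨hx', hy'⟩ := append_mem_concatCode.1 hxy'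
  rw [le_du_iff hℓ]
  rcases ne_or_eq x x' with h | rfl
  · obtain ⟨⟨i, hi⟩, hcmp⟩ := (le_du_iff hℓ).1 (hC.2 x hx x' hx' h)
    refine ⟨⟨i.castAdd n, by simpa using hi⟩, fun hle => ?_⟩
    obtain ⟨j, hj⟩ := hcmp (hle.imp (fun h k => by simpa using h (k.castAdd n))
      fun h k => by simpa using h (k.castAdd n))
    exact ⟨j.castAdd n, by simpa using hj⟩
  · have h : y ≠ y' := fun h => hne (by rw [h])
    obtain ⟨⟨i, hi⟩, hcmp⟩ := (le_du_iff hℓ).1 (hD.2 y hy y' hy' h)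
    refine ⟨⟨i.natAdd m, by simpa using hi⟩, fun hle => ?_⟩
    obtain ⟨j, hj⟩ := hcmp (hle.imp (fun h k => by simpa using h (k.natAdd m))
      fun h k => by simpa using h (k.natAdd m))
    exact ⟨j.natAdd m, by simpa using hj⟩

lemma bddAbove_card_isVTUEC {q ℓ : ℤ} (hℓ : 0 ≤ ℓ) (n : ℕ) :
    BddAbove {k : ℕ | ∃ C : Finset (Fin n → ℤ), IsVT q C ∧
      (∀ x ∈ C, ∀ y ∈ C, x ≠ y → 2 * ℓ + 1 ≤ du x y) ∧ C.card = k} := by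
  refine ⟨q.toNat ^ n, ?_⟩
  rintro k ⟨C, hvt, hd, rfl⟩
  refine IsVTUEC.card_le hℓ ?_ ⟨hvt, hd⟩
  nlinarith [Int.self_le_toNat q, mul_nonneg (Int.natCast_nonneg q.toNat) hℓ]

lemma IsVTUEC.card_le_LAu {q ℓ : ℤ} (hℓ : 0 ≤ ℓ) {n : ℕ} {C : Finset (Fin n → ℤ)}
    (hC : IsVTUEC q ℓ C) : C.card ≤ LAu q n ℓ :=
  le_csSup (bddAbove_card_isVTUEC hℓ n) ⟨C, hC.1, hC.2, rfl⟩

lemma exists_isVTUEC_card_eq_LAu {q ℓ : ℤ} (hq : 1 ≤ q) (hℓ : 0 ≤ ℓ) (n : ℕ) :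
    ∃ C : Finset (Fin n → ℤ), IsVTUEC q ℓ C ∧ C.card = LAu q n ℓ := by
  have h0 := isVTUEC_singleton_zero (ℓ := ℓ) hq n
  have hne : {k : ℕ | ∃ C : Finset (Fin n → ℤ), IsVT q C ∧
      (∀ x ∈ C, ∀ y ∈ C, x ≠ y → 2 * ℓ + 1 ≤ du x y) ∧ C.card = k}.Nonempty :=
    ⟨1, {0}, h0.1, h0.2, rfl⟩
  obtain ⟨C, h1, h2, h3⟩ := Nat.sSup_mem hne (bddAbove_card_isVTUEC hℓ n)
  exact ⟨C, ⟨h1, h2⟩, h3⟩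

lemma one_le_LAu {q ℓ : ℤ} (hq : 1 ≤ q) (hℓ : 0 ≤ ℓ) (n : ℕ) : 1 ≤ LAu q n ℓ :=
  (isVTUEC_singleton_zero hq n).card_le_LAu hℓ

lemma LAu_mul_le_LAu_add {q ℓ : ℤ} (hq : 1 ≤ q) (hℓ : 0 ≤ ℓ) (m n : ℕ) :
    LAu q m ℓ * LAu q n ℓ ≤ LAu q (m + n) ℓ := by
  obtain ⟨C, hC, hCc⟩ := exists_isVTUEC_card_eq_LAu hq hℓ m
  obtain ⟨D, hD, hDc⟩ := exists_isVTUEC_card_eq_LAu hq hℓ n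
  rw [← hCc, ← hDc, ← card_concatCode]
  exact (hC.concatCode hℓ hD).card_le_LAu hℓ

lemma LAu_le_pow {q ℓ : ℤ} (hq : 1 ≤ q) (hℓ : 0 ≤ ℓ) {K : ℕ} (hK : q ≤ K * (ℓ + 1)) (n : ℕ) :
    LAu q n ℓ ≤ K ^ n := by
  obtain ⟨C, hC, hCc⟩ := exists_isVTUEC_card_eq_LAu hq hℓ n
  exact hCc ▸ hC.card_le hℓ hK

/-- Fekete's lemma in multiplicative form. -/
lemma exists_tendsto_rpow_of_supermultiplicative {u : ℕ → ℕ} {K : ℕ} (h1 : ∀ n, 1 ≤ u n)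
    (hmul : ∀ m n, u m * u n ≤ u (m + n)) (hK : ∀ n, u n ≤ K ^ n) :
    ∃ β : ℝ, β ≤ K ∧ Tendsto (fun n : ℕ => (u n : ℝ) ^ (1 / (n : ℝ))) atTop (nhds β) := by
  have hpos : ∀ n, (0 : ℝ) < u n := fun n => by exact_mod_cast h1 n
  have hsub : Subadditive fun n => -Real.log (u n) := by
    intro m n
    have h : Real.log ((u m : ℝ) * u n) ≤ Real.log (u (m + n)) :=
      Real.log_le_log (mul_pos (hpos m) (hpos n)) (by exact_mod_cast hmul m n)
    rw [Real.log_mul (hpos m).ne' (hpos n).ne'] at h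
    linarith
  have hKpos : 1 ≤ K := by simpa using (h1 1).trans (hK 1)
  have hbdd : BddBelow (Set.range fun n : ℕ => -Real.log (u n) / n) := by
    refine ⟨-Real.log K, ?_⟩
    rintro _ ⟨n, rfl⟩
    have hlog : 0 ≤ Real.log K := Real.log_nonneg (by exact_mod_cast hKpos)
    rcases n.eq_zero_or_pos with rfl | hn
    · simpa using hlog
    · have h : Real.log (u n) ≤ Real.log ((K : ℝ) ^ n) :=
        Real.log_le_log (hpos n) (by exact_mod_cast hK n)
      rw [Real.log_pow] at h
      have hn' : (0 : ℝ) < n := by exact_mod_cast hn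
      simp only
      rw [le_div_iff₀ hn']
      linarith
  have hlim : Tendsto (fun n : ℕ => (u n : ℝ) ^ (1 / (n : ℝ))) atTop
      (nhds (Real.exp (-hsub.lim))) := by
    refine ((Real.continuous_exp.tendsto _).comp (hsub.tendsto_lim hbdd).neg).congr fun n => ?_
    rw [Function.comp_apply, Real.rpow_def_of_pos (hpos n)]
    congr 1
    ring
  refine ⟨_, le_of_tendsto hlim ?_, hlim⟩
  filter_upwards [eventually_ge_atTop 1] with n hn
  calc (u n : ℝ) ^ (1 / (n : ℝ)) ≤ ((K : ℝ) ^ n) ^ (1 / (n : ℝ)) :=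
        Real.rpow_le_rpow (hpos n).le (by exact_mod_cast hK n) (by positivity)
    _ = K := by
        rw [one_div]
        exact Real.pow_rpow_inv_natCast (Nat.cast_nonneg K) (by omega)

/-- there exists `β(ℓ,q) ≤ ⌈q/(ℓ+1)⌉` with
`lim_{n→∞} (LA_u(n,ℓ)_q)^{1/n} = β(ℓ,q)`. -/
theorem stmt18 (q ℓ : ℤ) (hq : 2 ≤ q) (hℓ0 : 0 ≤ ℓ) (hℓq : ℓ ≤ q - 2) :
    ∃ β : ℝ, β ≤ ((⌈(q : ℚ) / ((ℓ : ℚ) + 1)⌉ : ℤ) : ℝ) ∧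
      Filter.Tendsto (fun n : ℕ => (LAu q n ℓ : ℝ) ^ (1 / (n : ℝ)))
        Filter.atTop (nhds β) := by
  have hpos : (0 : ℚ) < (ℓ : ℚ) + 1 := by exact_mod_cast (by omega : 0 < ℓ + 1)
  have hKnonneg : 0 ≤ ⌈(q : ℚ) / ((ℓ : ℚ) + 1)⌉ :=
    Int.ceil_nonneg (div_nonneg (by exact_mod_cast (by omega : 0 ≤ q)) hpos.le)
  have hle := (div_le_iff₀ hpos).1 (Int.le_ceil ((q : ℚ) / ((ℓ : ℚ) + 1)))
  generalize ⌈(q : ℚ) / ((ℓ : ℚ) + 1)⌉ = K at hKnonneg hle ⊢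
  lift K to ℕ using hKnonneg
  have hK : q ≤ K * (ℓ + 1) := by exact_mod_cast hle
  simpa using exists_tendsto_rpow_of_supermultiplicative (one_le_LAu (by omega) hℓ0)
    (LAu_mul_le_LAu_add (by omega) hℓ0) (LAu_le_pow (by omega) hℓ0 hK)
end

section
/- Let q ≥ 2, n ≥ 1 and ℓ be integers with 1 ≤ ℓ < q, and let Q = {0,1,…,q−1}. For an integer i let P_i = {(a_1,…,a_n) ∈ Q^n : Σ_{j=1}^n a_j = i}, and for a ∈ {0,1,…,ℓn} let C_a = ⋃ {P_i : i ≡ a (mod ℓn + 1)}. Then C_a is an ℓ-UED code: for all distinct x, y ∈ C_a, either x and y are incomparable, or d(x,y) ≥ ℓ + 1. -/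
open Finset Filter

theorem abs_sub_le_dmax {n : ℕ} (x y : Fin n → ℤ) (i : Fin n) : |x i - y i| ≤ dmax x y := by
  rw [Int.abs_eq_natAbs, dmax]
  exact_mod_cast Finset.le_sup (f := fun i => (x i - y i).natAbs) (Finset.mem_univ i)

theorem dmax_comm {n : ℕ} (x y : Fin n → ℤ) : dmax x y = dmax y x := by
  have h (i : Fin n) : (x i - y i).natAbs = (y i - x i).natAbs := by omega
  simp only [dmax, h]

/-- Two distinct comparable words whose coordinate sums agree modulo `ℓn+1` are at
`d`-distance at least `ℓ+1`: otherwise the sums differ by an amount strictly between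
`0` and `ℓn+1`. -/
theorem add_one_le_dmax_of_le_of_modEq {n : ℕ} {ℓ : ℤ} {x y : Fin n → ℤ}
    (hle : ∀ i, y i ≤ x i) (hne : x ≠ y)
    (hmod : ∑ i, y i ≡ ∑ i, x i [ZMOD ℓ * n + 1]) : ℓ + 1 ≤ dmax x y := by
  by_contra! hd
  have hlt : ∑ i, y i < ∑ i, x i := by
    obtain ⟨i, hi⟩ := Function.ne_iff.mp hne
    exact Finset.sum_lt_sum (fun j _ => hle j)
      ⟨i, Finset.mem_univ i, lt_of_le_of_ne (hle i) hi.symm⟩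
  have hub : ∑ i, (x i - y i) ≤ ℓ * n := by
    have := Finset.sum_le_card_nsmul Finset.univ (fun i => x i - y i) ℓ fun i _ => by
      linarith [le_abs_self (x i - y i), abs_sub_le_dmax x y i]
    simpa [mul_comm] using this
  rw [Finset.sum_sub_distrib] at hub
  linarith [Int.le_of_dvd (sub_pos.mpr hlt) hmod.dvd]

/-- the code `C_a = ⋃ {P_i : i ≡ a (mod ℓn+1)}` is an `ℓ`-UED
code: any two distinct codewords are incomparable or at `d`-distance `≥ ℓ+1`. -/
theorem stmt19 (q : ℤ) (hq : 2 ≤ q) (n : ℕ) (hn : 1 ≤ n) (ℓ : ℤ)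
    (hℓ1 : 1 ≤ ℓ) (hℓq : ℓ < q) (a : ℤ) (ha0 : 0 ≤ a) (ha : a ≤ ℓ * n) :
    ∀ x ∈ {x : Fin n → ℤ | inQ q x ∧ (∑ j, x j) ≡ a [ZMOD ℓ * n + 1]},
      ∀ y ∈ {x : Fin n → ℤ | inQ q x ∧ (∑ j, x j) ≡ a [ZMOD ℓ * n + 1]},
        x ≠ y →
          ((¬ ∀ i, y i ≤ x i) ∧ (¬ ∀ i, x i ≤ y i)) ∨ ℓ + 1 ≤ dmax x y := by
  rintro x ⟨-, hx⟩ y ⟨-, hy⟩ hne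
  by_cases hyx : ∀ i, y i ≤ x i
  · exact Or.inr (add_one_le_dmax_of_le_of_modEq hyx hne (hy.trans hx.symm))
  by_cases hxy : ∀ i, x i ≤ y i
  · rw [dmax_comm]
    exact Or.inr (add_one_le_dmax_of_le_of_modEq hxy hne.symm (hx.trans hy.symm))
  exact Or.inl ⟨hyx, hxy⟩
end
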